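/- Let R be an algebraic curvature tensor on a Euclidean space of even dimension n = 2(k+2) ≥ 4. If both g^k R and *(g^k R) have nonnegative sectional curvature (i.e. nonnegative values on all decomposable (k+2)-vectors e_{i₁}∧⋯∧e_{i_{k+2}} paired with themselves), then h₄ = (1/(2k)!)⟨g^k R, *(g^k R)⟩ ≥ 0. -/

import Mathlib

open Finset

noncomputable section

/-- Double forms on the Euclidean space `ℝⁿ`: elements of `Λᵖ(ℝⁿ)* ⊗ Λ^q(ℝⁿ)*`,
represented by their (antisymmetric) coefficient arrays in the standard
orthonormal basis. -/
abbrev DForm (n p q : ℕ) := (Fin p → Fin n) → (Fin q → Fin n) → ℝ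

/-- Transport of a double form along equalities of the bidegree. -/
def castD {n p q p' q' : ℕ} (hp : p = p') (hq : q = q') (ω : DForm n p q) :
    DForm n p' q' :=
  fun x y => ω (x ∘ Fin.cast hp) (y ∘ Fin.cast hq)

/-- The product in the ring of double forms: the exterior product taken
simultaneously on both factors. -/
def dmul {n p q r s : ℕ} (ω : DForm n p q) (η : DForm n r s) :
    DForm n (p + r) (q + s) :=
  fun x y =>
    (1 / ((p.factorial * r.factorial * q.factorial * s.factorial : ℕ) : ℝ)) *
      ∑ σ : Equiv.Perm (Fin (p + r)), ∑ τ : Equiv.Perm (Fin (q + s)),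
        ((Equiv.Perm.sign σ : ℤ) : ℝ) * ((Equiv.Perm.sign τ : ℤ) : ℝ) *
          (ω (fun i => x (σ (Fin.castAdd r i))) (fun j => y (τ (Fin.castAdd s j))) *
           η (fun i => x (σ (Fin.natAdd p i))) (fun j => y (τ (Fin.natAdd q j))))

/-- The metric `g` of `ℝⁿ` as a double form of bidegree `(1,1)` (the identity
element of the contraction: the Kronecker delta). -/
def gform (n : ℕ) : DForm n 1 1 := fun x y => if x 0 = y 0 then 1 else 0

/-- Powers `g^k` of the metric in the ring of double forms. -/
def gpow (n : ℕ) : (k : ℕ) → DForm n k k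
  | 0 => fun _ _ => 1
  | k + 1 => castD (Nat.add_comm 1 k) (Nat.add_comm 1 k) (dmul (gform n) (gpow n k))

/-- The contraction map `c : D^{p+1,q+1} → D^{p,q}`. -/
def contr {n p q : ℕ} (ω : DForm n (p + 1) (q + 1)) : DForm n p q :=
  fun x y => ∑ j : Fin n, ω (Fin.cons j x) (Fin.cons j y)

/-- The natural inner product on `D^{p,q}` (for which the increasing basis
monomials are orthonormal). -/
def dinner {n p q : ℕ} (ω₁ ω₂ : DForm n p q) : ℝ :=
  (1 / ((p.factorial * q.factorial : ℕ) : ℝ)) *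
    ∑ x : Fin p → Fin n, ∑ y : Fin q → Fin n, ω₁ x y * ω₂ x y

/-- A coefficient array represents a double form iff it is antisymmetric in each
group of arguments. -/
def IsAlt {n p q : ℕ} (ω : DForm n p q) : Prop :=
  (∀ (σ : Equiv.Perm (Fin p)) (x : Fin p → Fin n) (y : Fin q → Fin n),
      ω (x ∘ σ) y = ((Equiv.Perm.sign σ : ℤ) : ℝ) * ω x y) ∧
  (∀ (τ : Equiv.Perm (Fin q)) (x : Fin p → Fin n) (y : Fin q → Fin n),
      ω x (y ∘ τ) = ((Equiv.Perm.sign τ : ℤ) : ℝ) * ω x y)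

/-- A double form in `D^{p,p}` is symmetric if it is invariant under exchanging
the two factors. -/
def IsSym {n p : ℕ} (ω : DForm n p p) : Prop := ∀ x y, ω x y = ω y x

/-- The first Bianchi map sends `D^{p,q+1}` to `D^{p+1,q}`; a double form satisfies
the first Bianchi identity when it lies in its kernel. -/
def FirstBianchi {n p q : ℕ} (ω : DForm n p (q + 1)) : Prop :=
  ∀ (x : Fin (p + 1) → Fin n) (y : Fin q → Fin n),
    ∑ k : Fin (p + 1),
      (-1 : ℝ) ^ (k : ℕ) * ω (x ∘ Fin.succAbove k) (Fin.cons (x k) y) = 0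

/-- The sign of a family `(f i)` of indices: the signature of `f` viewed as a
permutation if it is bijective, and `0` otherwise (Levi-Civita symbol). -/
def eps {n : ℕ} (f : Fin n → Fin n) : ℝ :=
  if h : Function.Bijective f then
    ((Equiv.Perm.sign (Equiv.ofBijective f h) : ℤ) : ℝ)
  else 0

/-- The Hodge star operator on double forms, acting as the usual Hodge star
simultaneously on both factors. -/
def dstar {n p q : ℕ} (hp : p ≤ n) (hq : q ≤ n) (ω : DForm n p q) :
    DForm n (n - p) (n - q) :=
  fun x y =>
    (1 / ((p.factorial * q.factorial : ℕ) : ℝ)) *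
      ∑ u : Fin p → Fin n, ∑ v : Fin q → Fin n,
        eps (fun i => Fin.append u x (Fin.cast (by omega) i)) *
        eps (fun i => Fin.append v y (Fin.cast (by omega) i)) * ω u v

/-- The evaluation of a double form `P ∈ D^{m,m}` on families of vectors of `ℝⁿ`,
by multilinear extension of its coefficients. -/
def evalD {n m : ℕ} (P : DForm n m m) (v w : Fin m → (Fin n → ℝ)) : ℝ :=
  ∑ x : Fin m → Fin n, ∑ y : Fin m → Fin n,
    (∏ i, v i (x i)) * (∏ j, w j (y j)) * P x y

/-- The action of a matrix on a covariant tensor, given by its array of coefficients. -/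
def push {n p : ℕ} (O : Matrix (Fin n) (Fin n) ℝ) (A : (Fin p → Fin n) → ℝ) :
    (Fin p → Fin n) → ℝ :=
  fun x => ∑ a, (∏ i, O (x i) (a i)) * A a

/-- The action of a matrix on both factors of a double form. -/
def rotate {n p q : ℕ} (O : Matrix (Fin n) (Fin n) ℝ) (ω : DForm n p q) : DForm n p q :=
  fun x y => push O (fun a => push O (ω a) y) x

section Push

variable {n p q : ℕ} (O : Matrix (Fin n) (Fin n) ℝ)

lemma push_sum {ι : Type*} (s : Finset ι) (A : ι → (Fin p → Fin n) → ℝ) (x : Fin p → Fin n) :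
    push O (fun a => ∑ i ∈ s, A i a) x = ∑ i ∈ s, push O (A i) x := by
  simp only [push, Finset.mul_sum]
  exact Finset.sum_comm

lemma push_const_mul (c : ℝ) (A : (Fin p → Fin n) → ℝ) (x : Fin p → Fin n) :
    push O (fun a => c * A a) x = c * push O A x := by
  simp only [push, Finset.mul_sum]
  exact Finset.sum_congr rfl fun a _ => by ring

lemma push_mul_const (c : ℝ) (A : (Fin p → Fin n) → ℝ) (x : Fin p → Fin n) :
    push O (fun a => A a * c) x = push O A x * c := by
  simp only [push, Finset.sum_mul, mul_assoc]

lemma push_comm (A : (Fin p → Fin n) → (Fin q → Fin n) → ℝ) (x : Fin p → Fin n)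
    (y : Fin q → Fin n) :
    push O (fun a => push O (A a) y) x = push O (fun b => push O (fun a => A a b) x) y := by
  simp only [push, Finset.mul_sum]
  rw [Finset.sum_comm]
  exact Finset.sum_congr rfl fun a _ => Finset.sum_congr rfl fun b _ => by ring

lemma push_push (M N : Matrix (Fin n) (Fin n) ℝ) (A : (Fin p → Fin n) → ℝ) :
    push M (push N A) = push (M * N) A := by
  funext x
  simp only [push, Finset.mul_sum, Matrix.mul_apply, Fintype.prod_sum, Finset.sum_mul]
  rw [Finset.sum_comm]
  refine Finset.sum_congr rfl fun a _ => Finset.sum_congr rfl fun b _ => ?_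
  rw [Finset.prod_mul_distrib, mul_assoc]

lemma push_one (A : (Fin p → Fin n) → ℝ) : push 1 A = A := by
  funext x
  simp only [push, Matrix.one_apply, Finset.prod_boole, Finset.mem_univ, true_implies]
  rw [Finset.sum_eq_single x]
  · simp
  · intro b _ hb
    rw [if_neg fun h => hb (funext fun i => (h i).symm), zero_mul]
  · simp

lemma sum_push_mul (A B : (Fin p → Fin n) → ℝ) :
    ∑ x, push O A x * B x = ∑ a, A a * push O.transpose B a := by
  simp only [push, Finset.sum_mul, Finset.mul_sum, Matrix.transpose_apply]
  rw [Finset.sum_comm]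
  exact Finset.sum_congr rfl fun a _ => Finset.sum_congr rfl fun b _ => by ring

lemma push_comp_equiv (σ : Fin q ≃ Fin p) (A : (Fin q → Fin n) → ℝ) (x : Fin p → Fin n) :
    push O (fun a => A (a ∘ σ)) x = push O A (x ∘ σ) := by
  refine Fintype.sum_equiv (σ.symm.arrowCongr (Equiv.refl _)) _ _ fun a => ?_
  have h : (σ.symm.arrowCongr (Equiv.refl (Fin n))) a = a ∘ σ := by
    funext i; simp [Equiv.arrowCongr]
  rw [h, ← σ.prod_comp]
  rfl

lemma push_append (A : (Fin p → Fin n) → (Fin q → Fin n) → ℝ) (x : Fin (p + q) → Fin n) :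
    push O (fun a => A (fun i => a (Fin.castAdd q i)) (fun i => a (Fin.natAdd p i))) x =
      push O (fun a => push O (A a) (fun i => x (Fin.natAdd p i)))
        (fun i => x (Fin.castAdd q i)) := by
  simp only [push, Finset.mul_sum]
  rw [← Fintype.sum_prod_type', ← (Fin.appendEquiv p q).sum_comp]
  refine Finset.sum_congr rfl fun a _ => ?_
  simp [Fin.appendEquiv, Fin.prod_univ_add, mul_assoc]

lemma push_cons (A : (Fin (p + 1) → Fin n) → ℝ) (j : Fin n) (x : Fin p → Fin n) :
    push O A (Fin.cons j x) = ∑ j', O j j' * push O (fun a => A (Fin.cons j' a)) x := by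
  simp only [push, Finset.mul_sum]
  rw [← Fintype.sum_prod_type', ← (Fin.consEquiv fun _ => Fin n).sum_comp]
  refine Finset.sum_congr rfl fun a _ => ?_
  simp [Fin.consEquiv, Fin.prod_univ_succ, mul_assoc]

lemma push_of_isEmpty (A : (Fin 0 → Fin n) → ℝ) (x : Fin 0 → Fin n) : push O A x = A x := by
  simp [push, Subsingleton.elim default x]

lemma push_singleton (A : (Fin 1 → Fin n) → ℝ) (j : Fin n) :
    push O A ![j] = ∑ j', O j j' * A ![j'] := by
  refine (push_cons O A j _).trans (Finset.sum_congr rfl fun j' _ => ?_)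
  rw [push_of_isEmpty]
  rfl

lemma rotate_castD {p' q' : ℕ} (hp : p = p') (hq : q = q') (ω : DForm n p q) :
    rotate O (castD hp hq ω) = castD hp hq (rotate O ω) := by
  subst hp hq
  rfl

lemma rotate_dmul {r s : ℕ} (ω : DForm n p q) (η : DForm n r s) :
    rotate O (dmul ω η) = dmul (rotate O ω) (rotate O η) := by
  have split (a b : ℕ) (A : (Fin a → Fin n) → ℝ) (B : (Fin b → Fin n) → ℝ)
      (σ : Equiv.Perm (Fin (a + b))) (x : Fin (a + b) → Fin n) :
      push O (fun x => A (fun i => x (σ (Fin.castAdd b i))) *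
        B (fun i => x (σ (Fin.natAdd a i)))) x =
      push O A (fun i => x (σ (Fin.castAdd b i))) *
        push O B (fun i => x (σ (Fin.natAdd a i))) := by
    refine (push_comp_equiv O σ (fun x => A (fun i => x (Fin.castAdd b i)) *
      B (fun i => x (Fin.natAdd a i))) x).trans ?_
    rw [push_append O (fun a b => A a * B b)]
    simp only [push_const_mul, push_mul_const]
    rfl
  funext x y
  change push O (fun a => push O (fun b => dmul ω η a b) y) x = _
  simp only [dmul, push_const_mul, push_sum, split]
  exact congrArg _ (Finset.sum_congr rfl fun σ _ => Finset.sum_congr rfl fun τ _ => congrArg _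
    (split p r (fun a => push O (ω a) fun j => y (τ (Fin.castAdd s j)))
      (fun a => push O (η a) fun j => y (τ (Fin.natAdd q j))) σ x))

lemma rotate_gform (hO : O * O.transpose = 1) : rotate O (gform n) = gform n := by
  funext x y
  obtain ⟨a, x, rfl⟩ : ∃ a x', x = Fin.cons a x' := ⟨x 0, Fin.tail x, (Fin.cons_self_tail x).symm⟩
  obtain ⟨b, y, rfl⟩ : ∃ b y', y = Fin.cons b y' := ⟨y 0, Fin.tail y, (Fin.cons_self_tail y).symm⟩
  have := congrFun (congrFun hO a) b
  simpa [rotate, push_cons, push_of_isEmpty, gform, Matrix.mul_apply, Matrix.one_apply] using this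

lemma rotate_gpow (hO : O * O.transpose = 1) (k : ℕ) : rotate O (gpow n k) = gpow n k := by
  induction k with
  | zero => funext x y; simp [rotate, gpow, push_of_isEmpty]
  | succ k ih => rw [gpow, rotate_castD, rotate_dmul, rotate_gform O hO, ih]

lemma contr_rotate (hO : O.transpose * O = 1) (ω : DForm n (p + 1) (q + 1)) :
    contr (rotate O ω) = rotate O (contr ω) := by
  funext x y
  have h (i j : Fin n) : ∑ c, O c i * O c j = if i = j then 1 else 0 := by
    simpa [Matrix.mul_apply, Matrix.one_apply] using congrFun (congrFun hO i) j
  change _ = push O (fun a => push O (fun b => contr ω a b) y) x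
  simp only [contr, rotate, push_cons, push_sum, push_const_mul, Finset.mul_sum]
  rw [Finset.sum_comm]
  refine Finset.sum_congr rfl fun i _ => ?_
  rw [Finset.sum_comm]
  simp only [← mul_assoc, ← Finset.sum_mul, h]
  simp

lemma dinner_rotate (hO : O.transpose * O = 1) (ω η : DForm n p q) :
    dinner (rotate O ω) (rotate O η) = dinner ω η := by
  have inv (r : ℕ) (A B : (Fin r → Fin n) → ℝ) :
      ∑ x, push O A x * push O B x = ∑ x, A x * B x := by
    rw [sum_push_mul, push_push, hO, push_one]
  have h2 : ∑ x, ∑ y, rotate O ω x y * rotate O η x y = ∑ x, ∑ y, ω x y * η x y := by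
    simp only [rotate]
    rw [Finset.sum_comm]
    simp only [inv]
    rw [Finset.sum_comm]
    simp only [inv]
  rw [dinner, dinner, h2]

lemma evalD_eq_rotate (P : DForm n p p) (x : Fin p → Fin n) :
    evalD P (fun i => O (x i)) (fun i => O (x i)) = rotate O P x x := by
  simp only [evalD, rotate, push, Finset.mul_sum, mul_assoc]

lemma isAlt_rotate {ω : DForm n p q} (h : IsAlt ω) : IsAlt (rotate O ω) := by
  constructor
  · intro σ x y
    have h1 (a : Fin p → Fin n) : ω (a ∘ σ) = fun b => ((Equiv.Perm.sign σ : ℤ) : ℝ) * ω a b :=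
      funext fun b => h.1 σ a b
    simp only [rotate]
    rw [← push_comp_equiv]
    simp only [h1, push_const_mul]
  · intro τ x y
    simp only [rotate, ← push_comp_equiv, h.2, push_const_mul]

lemma isSym_rotate {ω : DForm n p p} (h : IsSym ω) : IsSym (rotate O ω) := by
  intro x y
  rw [rotate, push_comm]
  congr 1
  funext b
  congr 1
  funext a
  exact h a b

end Push

section LeviCivita

variable {n m : ℕ}

lemma eps_perm (σ : Equiv.Perm (Fin n)) : eps σ = ((Equiv.Perm.sign σ : ℤ) : ℝ) := by
  rw [eps, dif_pos σ.bijective]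
  congr 3
  ext i
  rfl

lemma eps_perm_comp (π : Equiv.Perm (Fin n)) (f : Fin n → Fin n) :
    eps (π ∘ f) = ((Equiv.Perm.sign π : ℤ) : ℝ) * eps f := by
  by_cases h : Function.Bijective f
  · obtain ⟨σ, rfl⟩ : ∃ σ : Equiv.Perm (Fin n), ⇑σ = f := ⟨Equiv.ofBijective f h, rfl⟩
    rw [← Equiv.Perm.coe_mul, eps_perm, eps_perm]
    simp
  · have h' : ¬ Function.Bijective (π ∘ f) := by
      rwa [π.bijective.of_comp_iff' f]
    rw [eps, eps, dif_neg h, dif_neg h', mul_zero]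

lemma eps_comp_perm (f : Fin n → Fin n) (σ : Equiv.Perm (Fin n)) :
    eps (f ∘ σ) = ((Equiv.Perm.sign σ : ℤ) : ℝ) * eps f := by
  by_cases h : Function.Bijective f
  · obtain ⟨τ, rfl⟩ : ∃ τ : Equiv.Perm (Fin n), ⇑τ = f := ⟨Equiv.ofBijective f h, rfl⟩
    rw [← Equiv.Perm.coe_mul, eps_perm, eps_perm]
    simp [mul_comm]
  · have h' : ¬ Function.Bijective (f ∘ σ) := by
      rwa [σ.bijective.of_comp_iff f]
    rw [eps, eps, dif_neg h, dif_neg h', mul_zero]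

lemma perm_sign_mul_self {ι : Type*} [Fintype ι] [DecidableEq ι] (σ : Equiv.Perm ι) :
    ((Equiv.Perm.sign σ : ℤ) : ℝ) * ((Equiv.Perm.sign σ : ℤ) : ℝ) = 1 := by
  rcases Int.units_eq_one_or (Equiv.Perm.sign σ) with h | h <;> simp [h]

lemma eps_mul_self {f : Fin n → Fin n} (h : Function.Bijective f) : eps f * eps f = 1 := by
  rw [eps, dif_pos h, perm_sign_mul_self]

lemma push_eps (O : Matrix (Fin n) (Fin n) ℝ) (f : Fin n → Fin n) :
    push O eps f = O.det * eps f := by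
  have expand (M : Matrix (Fin n) (Fin n) ℝ) :
      ∑ g : Fin n → Fin n, (∏ i, M i (g i)) * eps g = M.det := by
    rw [← Matrix.det_transpose, Matrix.det_apply']
    symm
    refine Finset.sum_of_injOn (fun σ : Equiv.Perm (Fin n) => (σ : Fin n → Fin n))
      (fun σ _ τ _ h => Equiv.coe_fn_injective h) (by simp [Set.MapsTo]) ?_ ?_
    · intro g _ hg
      rw [eps, dif_neg, mul_zero]
      exact fun h => hg ⟨Equiv.ofBijective g h, by simp, rfl⟩
    · intro σ _
      rw [eps_perm, mul_comm]
      rfl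
  refine (expand (O.submatrix f id)).trans ?_
  by_cases h : Function.Bijective f
  · obtain ⟨σ, rfl⟩ : ∃ σ : Equiv.Perm (Fin n), ⇑σ = f := ⟨Equiv.ofBijective f h, rfl⟩
    rw [Matrix.det_permute, eps_perm, mul_comm]
  · rw [eps, dif_neg h, mul_zero]
    have hi : ¬ Function.Injective f := fun hi => h (Finite.injective_iff_bijective.mp hi)
    simp only [Function.Injective, not_forall] at hi
    obtain ⟨i, j, hij, hne⟩ := hi
    exact Matrix.det_zero_of_row_eq hne (by ext l; simp [hij])

/-- The Levi-Civita symbol of the concatenation of two families of half length. -/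
def epsPair (h : n = m + m) (u x : Fin m → Fin n) : ℝ :=
  eps fun i => Fin.append u x (Fin.cast h i)

variable (h : n = m + m)

lemma bijective_append_cast {u x : Fin m → Fin n} (hu : Function.Injective u)
    (hx : Function.Injective x) (hd : ∀ i j, u i ≠ x j) :
    Function.Bijective fun i => Fin.append u x (Fin.cast h i) :=
  Finite.injective_iff_bijective.mp
    ((Fin.append_injective_iff.mpr ⟨hu, hx, hd⟩).comp (Fin.cast_injective h))

lemma injective_of_epsPair_ne_zero {u x : Fin m → Fin n} (hne : epsPair h u x ≠ 0) :
    Function.Injective u ∧ Function.Injective x ∧ ∀ i j, u i ≠ x j := by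
  rw [epsPair, eps] at hne
  have hb : Function.Bijective fun i => Fin.append u x (Fin.cast h i) := by
    by_contra hb
    exact hne (dif_neg hb)
  refine Fin.append_injective_iff.mp fun a b hab => ?_
  have := @hb.1 (Fin.cast h.symm a) (Fin.cast h.symm b) (by simpa using hab)
  simpa using this

lemma epsPair_mul_self {u x : Fin m → Fin n} (hu : Function.Injective u)
    (hx : Function.Injective x) (hd : ∀ i j, u i ≠ x j) :
    epsPair h u x * epsPair h u x = 1 :=
  eps_mul_self (bijective_append_cast h hu hx hd)

lemma epsPair_perm_comp (π : Equiv.Perm (Fin n)) (u x : Fin m → Fin n) :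
    epsPair h (π ∘ u) (π ∘ x) = ((Equiv.Perm.sign π : ℤ) : ℝ) * epsPair h u x := by
  rw [epsPair, epsPair, ← eps_perm_comp]
  congr 1
  funext i
  simp only [Function.comp_apply]
  refine Fin.addCases (fun j => ?_) (fun j => ?_) (Fin.cast h i) <;>
    simp only [Fin.append_left, Fin.append_right, Function.comp_apply]

lemma epsPair_comp_perm (u x : Fin m → Fin n) (σ τ : Equiv.Perm (Fin m)) :
    epsPair h (u ∘ σ) (x ∘ τ) =
      ((Equiv.Perm.sign σ : ℤ) : ℝ) * ((Equiv.Perm.sign τ : ℤ) : ℝ) * epsPair h u x := by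
  subst h
  have key := eps_comp_perm (Fin.append u x) (finSumFinEquiv.permCongr (Equiv.Perm.sumCongr σ τ))
  rw [Equiv.Perm.sign_permCongr, Equiv.Perm.sign_sumCongr] at key
  push_cast at key
  rw [epsPair, epsPair]
  refine Eq.trans ?_ key
  congr 1
  funext i
  refine Fin.addCases (fun j => ?_) (fun j => ?_) i <;>
    simp [Equiv.permCongr_apply, -Fin.natAdd_eq_addNat]

lemma push_push_epsPair (O : Matrix (Fin n) (Fin n) ℝ) (u x : Fin m → Fin n) :
    push O (fun a => push O (epsPair h a) x) u = O.det * epsPair h u x := by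
  have hc : epsPair h = fun a b => eps (Fin.append a b ∘ finCongr h) := rfl
  have key := push_append O (epsPair h) (Fin.append u x)
  simp only [Fin.append_left, Fin.append_right] at key
  refine key.symm.trans ?_
  simp only [hc, Fin.append_castAdd_natAdd]
  rw [push_comp_equiv O (finCongr h) eps, push_eps]

lemma push_epsPair {O : Matrix (Fin n) (Fin n) ℝ} (hO : O.transpose * O = 1)
    (u x : Fin m → Fin n) :
    push O (epsPair h u) x = O.det * push O.transpose (fun a => epsPair h a x) u := by
  have key : push O (fun a => push O (epsPair h a) x) = fun u => O.det * epsPair h u x :=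
    funext fun u => push_push_epsPair h O u x
  have key2 := congrFun (congrArg (push O.transpose) key) u
  rwa [push_push, hO, push_one, push_const_mul] at key2

lemma push_sum_epsPair {O : Matrix (Fin n) (Fin n) ℝ} (hO : O.transpose * O = 1)
    (A : (Fin m → Fin n) → ℝ) (x : Fin m → Fin n) :
    push O (fun b => ∑ u, epsPair h u b * A u) x =
      O.det * ∑ u, epsPair h u x * push O A u := by
  simp only [push_sum, push_mul_const]
  have : ∀ u, push O (fun b => epsPair h u b) x = _ := fun u => push_epsPair h hO u x
  simp only [this]
  have adj := sum_push_mul O A (fun a => epsPair h a x)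
  simp only [mul_assoc, ← Finset.mul_sum]
  congr 1
  simp only [mul_comm] at adj ⊢
  exact adj.symm

lemma sum_epsPair_mul {A : (Fin m → Fin n) → ℝ}
    (hA : ∀ (σ : Equiv.Perm (Fin m)) u, A (u ∘ σ) = ((Equiv.Perm.sign σ : ℤ) : ℝ) * A u)
    {u x : Fin m → Fin n} (hu : Function.Injective u) (hx : Function.Injective x)
    (hd : ∀ i j, u i ≠ x j) :
    ∑ v, epsPair h v x * A v = m.factorial * (epsPair h u x * A u) := by
  have hs : ∑ σ : Equiv.Perm (Fin m), epsPair h (u ∘ σ) x * A (u ∘ σ) =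
      m.factorial * (epsPair h u x * A u) := by
    have : ∀ σ : Equiv.Perm (Fin m), epsPair h (u ∘ σ) x * A (u ∘ σ) = epsPair h u x * A u := by
      intro σ
      have h1 := epsPair_comp_perm h u x σ 1
      rw [Equiv.Perm.coe_one, Function.comp_id] at h1
      rw [h1, hA, Equiv.Perm.sign_one, Units.val_one]
      push_cast
      linear_combination (epsPair h u x * A u) * perm_sign_mul_self σ
    simp [this, Fintype.card_perm]
  rw [← hs]
  symm
  refine Finset.sum_of_injOn (fun σ : Equiv.Perm (Fin m) => u ∘ σ) ?_ (by simp [Set.MapsTo]) ?_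
    (fun _ _ => rfl)
  · exact fun σ _ τ _ hστ => Equiv.coe_fn_injective (hu.comp_left hστ)
  · intro v _ hv
    by_contra hne
    have hne' := left_ne_zero_of_mul hne
    obtain ⟨hvi, -, hvd⟩ := injective_of_epsPair_ne_zero h hne'
    have hb := (bijective_append_cast h hu hx hd).2
    have ex : ∀ i, ∃ j, u j = v i := by
      intro i
      obtain ⟨a, ha⟩ := hb (v i)
      simp only at ha
      generalize Fin.cast h a = b at ha
      induction b using Fin.addCases with
      | left j => exact ⟨j, by simpa using ha⟩
      | right j => exact absurd (by rw [← ha, Fin.append_right]) (hvd i j)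
    choose s hs using ex
    have hsi : Function.Injective s := fun a b hab => hvi (by rw [← hs a, ← hs b, hab])
    exact hv ⟨Equiv.ofBijective s (Finite.injective_iff_bijective.mp hsi), by simp,
      funext fun i => hs i⟩

end LeviCivita

section HodgeStar

variable {n m : ℕ} (h : n = m + m)

/-- The Hodge star operator on double forms in the middle degree. -/
def midStar (P : DForm n m m) : DForm n m m := fun x y =>
  (1 / ((m.factorial * m.factorial : ℕ) : ℝ)) *
    ∑ u, epsPair h u x * ∑ v, epsPair h v y * P u v

lemma castD_dstar_eq_midStar (hp : m ≤ n) (hq : n - m = m) (P : DForm n m m) :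
    castD hq hq (dstar hp hp P) = midStar h P := by
  have hE (u x : Fin m → Fin n) (h' : n = m + (n - m)) :
      eps (fun i => Fin.append u (x ∘ Fin.cast hq) (Fin.cast h' i)) = epsPair h u x := by
    rw [Fin.append_cast_right]
    rfl
  funext x y
  simp only [castD, dstar, midStar, hE, Finset.mul_sum, mul_assoc]

lemma rotate_midStar {O : Matrix (Fin n) (Fin n) ℝ} (hO : O.transpose * O = 1)
    (P : DForm n m m) : rotate O (midStar h P) = midStar h (rotate O P) := by
  have hdet : O.det * O.det = 1 := by
    have := congrArg Matrix.det hO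
    rwa [Matrix.det_mul, Matrix.det_transpose, Matrix.det_one] at this
  funext x y
  have inner (u : Fin m → Fin n) :
      push O (fun b => ∑ v, epsPair h v b * P u v) y =
        O.det * ∑ v, epsPair h v y * push O (P u) v := push_sum_epsPair h hO (P u) y
  change push O (fun a => push O (fun b => midStar h P a b) y) x = _
  simp only [midStar, push_const_mul]
  have step (a : Fin m → Fin n) :
      push O (fun b => ∑ u, epsPair h u a * ∑ v, epsPair h v b * P u v) y =
        ∑ u, epsPair h u a * (O.det * ∑ v, epsPair h v y * push O (P u) v) := by
    rw [push_sum]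
    exact Finset.sum_congr rfl fun u _ => by rw [push_const_mul, inner]
  simp only [step]
  rw [push_sum_epsPair h hO]
  have outer (u : Fin m → Fin n) :
      push O (fun u => O.det * ∑ v, epsPair h v y * push O (P u) v) u =
        O.det * ∑ v, epsPair h v y * rotate O P u v := by
    simp only [push_const_mul, push_sum]
    rfl
  simp only [outer, mul_left_comm _ O.det, ← Finset.mul_sum]
  rw [← mul_assoc O.det, hdet, one_mul]

lemma isAlt_midStar (P : DForm n m m) : IsAlt (midStar h P) := by
  have hE (u x : Fin m → Fin n) (τ : Equiv.Perm (Fin m)) :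
      epsPair h u (x ∘ τ) = ((Equiv.Perm.sign τ : ℤ) : ℝ) * epsPair h u x := by
    simpa using epsPair_comp_perm h u x 1 τ
  constructor <;> intro σ x y <;> simp only [midStar, hE] <;>
    generalize ((Equiv.Perm.sign σ : ℤ) : ℝ) = c <;>
    simp only [Finset.mul_sum] <;>
    exact Finset.sum_congr rfl fun u _ => Finset.sum_congr rfl fun v _ => by ring

lemma midStar_apply {P : DForm n m m} (hP : IsAlt P) {u v x y : Fin m → Fin n}
    (hu : Function.Injective u) (hx : Function.Injective x) (hux : ∀ i j, u i ≠ x j)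
    (hv : Function.Injective v) (hy : Function.Injective y) (hvy : ∀ i j, v i ≠ y j) :
    midStar h P x y = epsPair h u x * epsPair h v y * P u v := by
  have h1 (u : Fin m → Fin n) := sum_epsPair_mul h (hP.2 · u ·) hv hy hvy
  have h2 := sum_epsPair_mul h (A := fun u => P u v) (hP.1 · · v) hu hx hux
  have hf : (m.factorial : ℝ) ≠ 0 := by positivity
  have h3 : ∑ a, epsPair h a x * ∑ b, epsPair h b y * P a b =
      (m.factorial * epsPair h v y) * ∑ a, epsPair h a x * P a v := by
    rw [Finset.mul_sum]
    exact Finset.sum_congr rfl fun a _ => by rw [h1]; ring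
  rw [midStar, h3, h2]
  push_cast
  field_simp

end HodgeStar

section MetricPowers

variable {n k : ℕ}

lemma isAlt_dmul {p q r s : ℕ} (ω : DForm n p q) (η : DForm n r s) : IsAlt (dmul ω η) := by
  constructor
  · intro ρ x y
    simp only [dmul, Finset.mul_sum]
    refine Fintype.sum_equiv (Equiv.mulLeft ρ) _ _ fun σ => Finset.sum_congr rfl fun τ _ => ?_
    simp only [Equiv.coe_mulLeft, Equiv.Perm.sign_mul, Equiv.Perm.mul_apply, Function.comp_apply]
    rcases Int.units_eq_one_or (Equiv.Perm.sign ρ) with h | h <;> rw [h] <;> push_cast <;> ring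
  · intro ρ x y
    simp only [dmul, Finset.mul_sum]
    refine Finset.sum_congr rfl fun σ _ => Fintype.sum_equiv (Equiv.mulLeft ρ) _ _ fun τ => ?_
    simp only [Equiv.coe_mulLeft, Equiv.Perm.sign_mul, Equiv.Perm.mul_apply, Function.comp_apply]
    rcases Int.units_eq_one_or (Equiv.Perm.sign ρ) with h | h <;> rw [h] <;> push_cast <;> ring

lemma isSym_dmul {p r : ℕ} {ω : DForm n p p} {η : DForm n r r} (hω : IsSym ω) (hη : IsSym η) :
    IsSym (dmul ω η) := by
  intro x y
  simp only [dmul]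
  rw [Finset.sum_comm]
  congr 1
  refine Finset.sum_congr rfl fun σ _ => Finset.sum_congr rfl fun τ _ => ?_
  rw [hω, hη]
  ring

lemma isSym_gpow (k : ℕ) : IsSym (gpow n k) := by
  induction k with
  | zero => exact fun _ _ => rfl
  | succ k ih =>
    have hg : IsSym (gform n) := fun x y => by simp [gform, eq_comm]
    exact fun x y => isSym_dmul hg ih _ _

lemma gpow_congr {x y x' y' : Fin k → Fin n} (h : ∀ i j, x i = y j ↔ x' i = y' j) :
    gpow n k x y = gpow n k x' y' := by
  induction k with
  | zero => rfl
  | succ k ih =>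
    simp only [gpow, castD, dmul]
    congr 1
    refine Finset.sum_congr rfl fun σ _ => Finset.sum_congr rfl fun τ _ => ?_
    congr 2
    · simp only [gform, Function.comp_apply, h]
    · exact ih fun i j => h _ _

lemma exists_eq_of_gpow_ne_zero {x y : Fin k → Fin n} (h : gpow n k x y ≠ 0) (i : Fin k) :
    ∃ j, x i = y j := by
  induction k with
  | zero => exact i.elim0
  | succ k ih =>
    simp only [gpow, castD, dmul] at h
    obtain ⟨σ, -, hσ⟩ := Finset.exists_ne_zero_of_sum_ne_zero (right_ne_zero_of_mul h)
    obtain ⟨τ, -, hτ⟩ := Finset.exists_ne_zero_of_sum_ne_zero hσ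
    have hg := left_ne_zero_of_mul (right_ne_zero_of_mul hτ)
    have hr := right_ne_zero_of_mul (right_ne_zero_of_mul hτ)
    obtain ⟨a, rfl⟩ : ∃ a, Fin.cast (Nat.add_comm 1 k) (σ a) = i :=
      ⟨σ.symm (Fin.cast (Nat.add_comm 1 k).symm i), by simp⟩
    induction a using Fin.addCases with
    | left a =>
      rw [Subsingleton.elim a 0]
      exact ⟨_, by_contra fun hne => hg (if_neg hne)⟩
    | right a =>
      obtain ⟨j, hj⟩ := ih hr a
      exact ⟨_, hj⟩

section Support

variable {x y : Fin (k + 2) → Fin n} {σ τ : Equiv.Perm (Fin (k + 2))}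

lemma exists_tail_eq_left (hxy : ∀ i j, x i = y j → i = j)
    (hG : gpow n k (fun i => x (σ (Fin.castAdd 2 i))) (fun j => y (τ (Fin.castAdd 2 j))) ≠ 0)
    {p : Fin (k + 2)} (hp : x p ≠ y p ∨ ∃ a, τ (Fin.natAdd k a) = p) :
    ∃ a, σ (Fin.natAdd k a) = p := by
  obtain ⟨b, rfl⟩ := σ.surjective p
  induction b using Fin.addCases with
  | right a => exact ⟨a, rfl⟩
  | left i =>
    exfalso
    obtain ⟨j, hj⟩ := exists_eq_of_gpow_ne_zero hG i
    have hij := hxy _ _ hj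
    rcases hp with hp | ⟨a, ha⟩
    · exact hp (by rw [hj, hij])
    · have := τ.injective (ha.trans hij)
      have := congrArg Fin.val this
      simp at this
      omega

lemma exists_tail_eq_right (hxy : ∀ i j, x i = y j → i = j)
    (hG : gpow n k (fun i => x (σ (Fin.castAdd 2 i))) (fun j => y (τ (Fin.castAdd 2 j))) ≠ 0)
    {p : Fin (k + 2)} (hp : x p ≠ y p ∨ ∃ a, σ (Fin.natAdd k a) = p) :
    ∃ a, τ (Fin.natAdd k a) = p := by
  rw [isSym_gpow] at hG
  exact exists_tail_eq_left (fun i j h => (hxy j i h.symm).symm) hG (hp.imp_left Ne.symm)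

end Support

variable {R : DForm n 2 2} {x y x' y' : Fin (k + 2) → Fin n}

lemma dmul_gpow_eq_of_two_ne (hxy : ∀ i j, x i = y j → i = j)
    (h : ∀ i j, x i = y j ↔ x' i = y' j) (hx' : ∀ i, x i ≠ y i → x' i = x i)
    (hy' : ∀ i, x i ≠ y i → y' i = y i) {z₁ z₂ : Fin (k + 2)} (hz : z₁ ≠ z₂)
    (hz₁ : x z₁ ≠ y z₁) (hz₂ : x z₂ ≠ y z₂) :
    dmul (gpow n k) R x y = dmul (gpow n k) R x' y' := by
  simp only [dmul]
  congr 1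
  refine Finset.sum_congr rfl fun σ _ => Finset.sum_congr rfl fun τ _ => ?_
  congr 1
  rw [← gpow_congr fun i j => h (σ (Fin.castAdd 2 i)) (τ (Fin.castAdd 2 j))]
  by_cases hG : gpow n k (fun i => x (σ (Fin.castAdd 2 i))) (fun j => y (τ (Fin.castAdd 2 j))) = 0
  · rw [hG, zero_mul, zero_mul]
  have two (f : Fin 2 → Fin (k + 2)) (h₁ : ∃ a, f a = z₁) (h₂ : ∃ a, f a = z₂) (a : Fin 2) :
      f a = z₁ ∨ f a = z₂ := by
    obtain ⟨a₁, h₁⟩ := h₁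
    obtain ⟨a₂, h₂⟩ := h₂
    have : a₁ ≠ a₂ := fun e => hz (by rw [← h₁, ← h₂, e])
    have : a = a₁ ∨ a = a₂ := by omega
    exact this.imp (fun e : a = a₁ => e ▸ h₁) (fun e : a = a₂ => e ▸ h₂)
  congr 2
  · funext a
    refine (hx' _ ?_).symm
    rcases two (fun a => σ (Fin.natAdd k a)) (exists_tail_eq_left hxy hG (.inl hz₁))
      (exists_tail_eq_left hxy hG (.inl hz₂)) a with e | e <;> rwa [e]
  · funext a
    refine (hy' _ ?_).symm
    rcases two (fun a => τ (Fin.natAdd k a)) (exists_tail_eq_right hxy hG (.inl hz₁))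
      (exists_tail_eq_right hxy hG (.inl hz₂)) a with e | e <;> rwa [e]

lemma dmul_gpow_eq_zero_of_three_ne (hxy : ∀ i j, x i = y j → i = j) {z₁ z₂ z₃ : Fin (k + 2)}
    (h₁₂ : z₁ ≠ z₂) (h₁₃ : z₁ ≠ z₃) (h₂₃ : z₂ ≠ z₃)
    (hz₁ : x z₁ ≠ y z₁) (hz₂ : x z₂ ≠ y z₂) (hz₃ : x z₃ ≠ y z₃) :
    dmul (gpow n k) R x y = 0 := by
  rw [dmul, Finset.sum_eq_zero, mul_zero]
  refine fun σ _ => Finset.sum_eq_zero fun τ _ => ?_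
  by_cases hG : gpow n k (fun i => x (σ (Fin.castAdd 2 i))) (fun j => y (τ (Fin.castAdd 2 j))) = 0
  · rw [hG, zero_mul, mul_zero]
  exfalso
  obtain ⟨a₁, h₁⟩ := exists_tail_eq_left hxy hG (.inl hz₁)
  obtain ⟨a₂, h₂⟩ := exists_tail_eq_left hxy hG (.inl hz₂)
  obtain ⟨a₃, h₃⟩ := exists_tail_eq_left hxy hG (.inl hz₃)
  have e₁₂ : a₁ ≠ a₂ := fun e => h₁₂ (by rw [← h₁, ← h₂, e])
  have e₁₃ : a₁ ≠ a₃ := fun e => h₁₃ (by rw [← h₁, ← h₃, e])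
  have e₂₃ : a₂ ≠ a₃ := fun e => h₂₃ (by rw [← h₂, ← h₃, e])
  omega

/-- The coefficient array of the double form `(eₚ ∧ e_z) ⊗ (eₚ ∧ e_z)`. -/
def planeForm {ι : Type*} [DecidableEq ι] (p z : ι) (f g : Fin 2 → ι) : ℝ :=
  ((if f 0 = p ∧ f 1 = z then 1 else 0) - if f 1 = p ∧ f 0 = z then 1 else 0) *
    ((if g 0 = p ∧ g 1 = z then 1 else 0) - if g 1 = p ∧ g 0 = z then 1 else 0)

/-- The coefficient of the sectional term of the plane `(p, z)` in the value of `g^k R`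
on the families `x` and `y`. -/
def planeWeight (x y : Fin (k + 2) → Fin n) (z p : Fin (k + 2)) : ℝ :=
  (1 / ((k.factorial * Nat.factorial 2 * k.factorial * Nat.factorial 2 : ℕ) : ℝ)) *
    ∑ σ : Equiv.Perm (Fin (k + 2)), ∑ τ : Equiv.Perm (Fin (k + 2)),
      ((Equiv.Perm.sign σ : ℤ) : ℝ) * ((Equiv.Perm.sign τ : ℤ) : ℝ) *
        (gpow n k (fun i => x (σ (Fin.castAdd 2 i))) (fun j => y (τ (Fin.castAdd 2 j))) *
          planeForm p z (fun i => σ (Fin.natAdd k i)) (fun j => τ (Fin.natAdd k j)))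

lemma planeWeight_eq {z : Fin (k + 2)} (hxy : ∀ i j, x i = y j ↔ i = j ∧ i ≠ z)
    {p q : Fin (k + 2)} (hp : p ≠ z) (hq : q ≠ z) :
    planeWeight x y z p = planeWeight x y z q := by
  let π := Equiv.swap p q
  have hπ (i : Fin (k + 2)) : π i = z ↔ i = z := by
    rw [← Equiv.swap_apply_of_ne_of_ne hp.symm hq.symm, π.apply_eq_iff_eq]
    rw [Equiv.swap_apply_of_ne_of_ne hp.symm hq.symm]
  have hπ' (i : Fin (k + 2)) : π i = q ↔ i = p := by
    rw [← Equiv.swap_apply_left p q, π.apply_eq_iff_eq]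
  rw [planeWeight, planeWeight]
  congr 1
  refine Fintype.sum_equiv (Equiv.mulLeft π) _ _ fun σ =>
    Fintype.sum_equiv (Equiv.mulLeft π) _ _ fun τ => ?_
  simp only [Equiv.coe_mulLeft, Equiv.Perm.sign_mul, Equiv.Perm.mul_apply, planeForm, hπ, hπ']
  rw [gpow_congr (x' := fun i => x (π (σ (Fin.castAdd 2 i))))
    (y' := fun j => y (π (τ (Fin.castAdd 2 j))))
    fun i j => by simp only [hxy, Ne, hπ, π.apply_eq_iff_eq]]
  rcases Int.units_eq_one_or (Equiv.Perm.sign π) with h | h <;> rw [h] <;> push_cast <;> ring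

lemma IsAlt.swap_left {R : DForm n 2 2} (h : IsAlt R) (a b : Fin n) (y : Fin 2 → Fin n) :
    R ![a, b] y = -R ![b, a] y := by
  have e : ![a, b] = ![b, a] ∘ Equiv.swap 0 1 := by
    funext i; fin_cases i <;> simp
  rw [e, h.1, Equiv.Perm.sign_swap (by decide)]
  simp

lemma IsAlt.swap_right {R : DForm n 2 2} (h : IsAlt R) (x : Fin 2 → Fin n) (a b : Fin n) :
    R x ![a, b] = -R x ![b, a] := by
  have e : ![a, b] = ![b, a] ∘ Equiv.swap 0 1 := by
    funext i; fin_cases i <;> simp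
  rw [e, h.2, Equiv.Perm.sign_swap (by decide)]
  simp

lemma dmul_gpow_eq_sum_planeWeight (hR : IsAlt R) {z : Fin (k + 2)}
    (hxy : ∀ i j, x i = y j ↔ i = j ∧ i ≠ z) (hxy' : ∀ i j, x' i = y' j ↔ i = j ∧ i ≠ z) :
    dmul (gpow n k) R x' y' =
      ∑ p, planeWeight x y z p * R ![x' p, x' z] ![y' p, y' z] := by
  simp only [planeWeight, dmul, mul_assoc, ← Finset.mul_sum, Finset.sum_mul]
  rw [Finset.sum_comm]
  congr 1
  refine Finset.sum_congr rfl fun σ _ => ?_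
  rw [← Finset.mul_sum, Finset.sum_comm]
  congr 1
  refine Finset.sum_congr rfl fun τ _ => ?_
  simp only [← Finset.mul_sum]
  congr 1
  rw [gpow_congr (x' := fun i => x (σ (Fin.castAdd 2 i))) (y' := fun j => y (τ (Fin.castAdd 2 j)))
    fun i j => by simp only [hxy, hxy']]
  by_cases hG : gpow n k (fun i => x (σ (Fin.castAdd 2 i))) (fun j => y (τ (Fin.castAdd 2 j))) = 0
  · rw [hG, zero_mul, zero_mul]
  congr 1
  have hxz : ∀ i j, x i = y j → i = j := fun i j h => ((hxy i j).mp h).1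
  have hz : x z ≠ y z := fun h => ((hxy z z).mp h).2 rfl
  have hσz := exists_tail_eq_left hxz hG (.inl hz)
  have hτz := exists_tail_eq_right hxz hG (.inl hz)
  have hστ : ∀ a, ∃ b, τ (Fin.natAdd k b) = σ (Fin.natAdd k a) := fun a =>
    exists_tail_eq_right hxz hG (.inr ⟨a, rfl⟩)
  have hne (ρ : Equiv.Perm (Fin (k + 2))) : ρ (Fin.natAdd k 0) ≠ ρ (Fin.natAdd k 1) := fun h => by
    have := congrArg Fin.val (ρ.injective h)
    simp at this
  have hσne := hne σ
  have hτne := hne τ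
  have pair {α : Type} (w : Fin (k + 2) → α) (ρ : Equiv.Perm (Fin (k + 2))) :
      (fun i => w (ρ (Fin.natAdd k i))) =
        ![w (ρ (Fin.natAdd k 0)), w (ρ (Fin.natAdd k 1))] := by
    funext i; fin_cases i <;> rfl
  have pair_id (ρ : Equiv.Perm (Fin (k + 2))) : (fun i => ρ (Fin.natAdd k i)) =
      ![ρ (Fin.natAdd k 0), ρ (Fin.natAdd k 1)] := pair id ρ
  rw [pair x', pair y']
  simp only [pair_id]
  simp only [Fin.exists_fin_two, Fin.forall_fin_two] at hσz hτz hστ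
  generalize σ (Fin.natAdd k 0) = s₀ at *
  generalize σ (Fin.natAdd k 1) = s₁ at *
  generalize τ (Fin.natAdd k 0) = t₀ at *
  generalize τ (Fin.natAdd k 1) = t₁ at *
  obtain ⟨q, hqz, hs, ht⟩ : ∃ q, q ≠ z ∧ (s₀ = q ∧ s₁ = z ∨ s₀ = z ∧ s₁ = q) ∧
      (t₀ = q ∧ t₁ = z ∨ t₀ = z ∧ t₁ = q) := by
    rcases hσz with h | h
    · exact ⟨s₁, by grind, by grind, by grind⟩
    · exact ⟨s₀, by grind, by grind, by grind⟩
  have hl := hR.swap_left (x' z) (x' q)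
  have hr := fun w => hR.swap_right w (y' z) (y' q)
  rw [Finset.sum_eq_single q]
  · rcases hs with ⟨rfl, rfl⟩ | ⟨rfl, rfl⟩ <;> rcases ht with ⟨rfl, rfl⟩ | ⟨rfl, rfl⟩ <;>
      simp [planeForm, hqz, hqz.symm, hl, hr]
  · intro p _ hpq
    rw [planeForm]
    simp only [Matrix.cons_val_zero, Matrix.cons_val_one]
    grind
  · simp

end MetricPowers

section Positivity

variable {n m k : ℕ}

lemma IsAlt.eq_zero_left {p q : ℕ} {ω : DForm n p q} (h : IsAlt ω) {x : Fin p → Fin n}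
    (hx : ¬ Function.Injective x) (y : Fin q → Fin n) : ω x y = 0 := by
  simp only [Function.Injective, not_forall] at hx
  obtain ⟨i, j, hij, hne⟩ := hx
  have hc : x ∘ Equiv.swap i j = x := by
    rw [Equiv.comp_swap_eq_update, hij, Function.update_eq_self, ← hij, Function.update_eq_self]
  have := h.1 (Equiv.swap i j) x y
  rw [hc, Equiv.Perm.sign_swap hne] at this
  push_cast at this
  linarith

lemma IsAlt.eq_zero_right {p q : ℕ} {ω : DForm n p q} (h : IsAlt ω) (x : Fin p → Fin n)
    {y : Fin q → Fin n} (hy : ¬ Function.Injective y) : ω x y = 0 :=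
  IsAlt.eq_zero_left (ω := fun y x => ω x y) ⟨fun σ y x => h.2 σ x y, fun σ y x => h.1 σ x y⟩ hy x

lemma exists_disjoint_injective (h : n = m + m) {x : Fin m → Fin n}
    (hx : Function.Injective x) :
    ∃ u : Fin m → Fin n, Function.Injective u ∧ ∀ i j, u i ≠ x j := by
  have hc : (Finset.univ.image x)ᶜ.card = m := by
    rw [Finset.card_compl, Finset.card_image_of_injective _ hx]
    simp [h]
  refine ⟨Finset.orderEmbOfFin _ hc, (Finset.orderEmbOfFin _ hc).injective, fun i j hij => ?_⟩
  have := Finset.orderEmbOfFin_mem _ hc i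
  rw [hij] at this
  simp at this

lemma exists_perm_aligned {y u : Fin m → Fin n} (hy : Function.Injective y)
    (hu : Function.Injective u) :
    ∃ τ : Equiv.Perm (Fin m), ∀ i j, y i = u (τ j) → i = j := by
  classical
  rcases isEmpty_or_nonempty (Fin m) with _ | _
  · exact ⟨1, fun i => isEmptyElim i⟩
  let s : Finset (Fin m) := {i | ∃ j, u j = y i}
  have hs {i : Fin m} (hi : i ∈ s) : u (Function.invFun u (y i)) = y i :=
    Function.invFun_eq (by simpa [s] using hi)
  obtain ⟨g, hg⟩ := Finset.exists_equiv_extend_of_card_eq (α := Fin m) (t := Finset.univ)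
    (s := s) (f := fun i => Function.invFun u (y i)) (by simp) (Finset.subset_univ _)
    (fun i hi j hj hij => hy (by rw [← hs hi, ← hs hj]; exact congrArg u hij))
  refine ⟨g.trans (Equiv.subtypeUnivEquiv Finset.mem_univ), fun i j hij => ?_⟩
  have hi : i ∈ s := by simpa [s] using ⟨_, hij.symm⟩
  apply (g.trans (Equiv.subtypeUnivEquiv Finset.mem_univ)).injective
  apply hu
  rw [← hij, ← hs hi]
  exact congrArg u (hg i hi)

lemma dmul_gpow_add_eq_zero (h : n = (k + 2) + (k + 2)) {R : DForm n 2 2} (hR : IsAlt R)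
    (hric : ∀ a b, a ≠ b → ∑ c, R ![c, a] ![c, b] = 0) {x y u v : Fin (k + 2) → Fin n}
    (hu : Function.Injective u) (hx : Function.Injective x) (hux : ∀ i j, u i ≠ x j)
    {z : Fin (k + 2)} (hxy : ∀ i j, x i = y j ↔ i = j ∧ i ≠ z)
    (hvu : ∀ i j, v i = u j ↔ i = j ∧ i ≠ z) (hv : v z = x z) (hy : u z = y z) :
    dmul (gpow n k) R x y + dmul (gpow n k) R v u = 0 := by
  obtain ⟨p₀, hp₀⟩ := exists_ne z
  have hl (a : Fin n) (w) : R ![a, a] w = 0 :=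
    hR.eq_zero_left (fun hi => by simpa using @hi 0 1 (by simp)) w
  have hr (a : Fin n) (w) : R w ![a, a] = 0 :=
    hR.eq_zero_right w (fun hi => by simpa using @hi 0 1 (by simp))
  have hne : x z ≠ y z := fun e => ((hxy z z).mp e).2 rfl
  have h₁ (p : Fin (k + 2)) : planeWeight x y z p * R ![x p, x z] ![y p, y z] =
      planeWeight x y z p₀ * R ![x p, x z] ![x p, y z] := by
    by_cases hp : p = z
    · rw [hp, hl, hl, mul_zero, mul_zero]
    · rw [planeWeight_eq hxy hp hp₀, (hxy p p).mpr ⟨rfl, hp⟩]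
  have h₂ (p : Fin (k + 2)) : planeWeight x y z p * R ![v p, v z] ![u p, u z] =
      planeWeight x y z p₀ * R ![u p, x z] ![u p, y z] := by
    by_cases hp : p = z
    · rw [hp, hl, hy, hr, mul_zero, mul_zero]
    · rw [planeWeight_eq hxy hp hp₀, (hvu p p).mpr ⟨rfl, hp⟩, hv, hy]
  have hsum := (bijective_append_cast h hu hx hux).sum_comp
    (fun c => R ![c, x z] ![c, y z])
  rw [hric _ _ hne, ← (finCongr h).symm.sum_comp] at hsum
  simp only [finCongr_symm, finCongr_apply, Fin.cast_cast, Fin.cast_eq_self] at hsum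
  rw [Fin.sum_univ_add] at hsum
  simp only [Fin.append_left, Fin.append_right] at hsum
  rw [dmul_gpow_eq_sum_planeWeight hR hxy hxy, dmul_gpow_eq_sum_planeWeight hR hxy hvu]
  simp only [h₁, h₂, ← Finset.mul_sum]
  rw [← mul_add, add_comm, hsum, mul_zero]

lemma midStar_eq_of_aligned (h : n = (k + 2) + (k + 2)) {R : DForm n 2 2} (hR : IsAlt R)
    (hsym : IsSym R) (hric : ∀ a b, a ≠ b → ∑ c, R ![c, a] ![c, b] = 0)
    {x y u : Fin (k + 2) → Fin n} (hx : Function.Injective x) (hy : Function.Injective y)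
    (hu : Function.Injective u) (hxy : ∀ i j, x i = y j → i = j) (hux : ∀ i j, u i ≠ x j)
    (hyu : ∀ i j, y i = u j → i = j) {z : Fin (k + 2)} (hz : x z ≠ y z) :
    midStar h (dmul (gpow n k) R) x y = dmul (gpow n k) R x y := by
  have hcover (c : Fin n) : (∃ j, u j = c) ∨ ∃ j, x j = c := by
    obtain ⟨a, ha⟩ := (bijective_append_cast h hu hx hux).2 c
    simp only at ha
    generalize Fin.cast h a = b at ha
    induction b using Fin.addCases with
    | left j => exact .inl ⟨j, by simpa using ha⟩
    | right j => exact .inr ⟨j, by rw [← ha, Fin.append_right]⟩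
  have hu' (i : Fin (k + 2)) (hi : x i ≠ y i) : u i = y i := by
    rcases hcover (y i) with ⟨j, hj⟩ | ⟨j, hj⟩
    · rw [← hj, hyu i j hj.symm]
    · exact absurd (hxy j i hj ▸ hj) hi
  obtain ⟨v, hv⟩ : ∃ v : Fin (k + 2) → Fin n, ∀ i, v i = if x i = y i then u i else x i :=
    ⟨_, fun _ => rfl⟩
  have hv₁ (i : Fin (k + 2)) (hi : x i = y i) : v i = u i := by rw [hv, if_pos hi]
  have hv₂ (i : Fin (k + 2)) (hi : x i ≠ y i) : v i = x i := by rw [hv, if_neg hi]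
  have hvi : Function.Injective v := by
    intro i j hij
    by_cases hi : x i = y i <;> by_cases hj : x j = y j
    · exact hu (by rw [← hv₁ i hi, ← hv₁ j hj, hij])
    · exact absurd (by rw [← hv₁ i hi, ← hv₂ j hj, hij]) (hux i j)
    · exact absurd (by rw [← hv₁ j hj, ← hv₂ i hi, hij]) (hux j i)
    · exact hx (by rw [← hv₂ i hi, ← hv₂ j hj, hij])
  have hvy (i j : Fin (k + 2)) : v i ≠ y j := by
    intro hij
    by_cases hi : x i = y i
    · rw [hv₁ i hi] at hij
      obtain rfl := hyu j i hij.symm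
      exact hux j j (hij.trans hi.symm)
    · rw [hv₂ i hi] at hij
      obtain rfl := hxy i j hij
      exact hi hij
  have hvu (i j : Fin (k + 2)) : x i = y j ↔ v i = u j := by
    by_cases hi : x i = y i
    · rw [hv₁ i hi, hi, hy.eq_iff, hu.eq_iff]
    · rw [hv₂ i hi]
      exact ⟨fun e => absurd (hxy i j e ▸ e) hi, fun e => absurd e.symm (hux j i)⟩
  have hE := epsPair_mul_self h hu hx hux
  rw [midStar_apply h (isAlt_dmul _ _) hu hx hux hvi hy hvy,
    isSym_dmul (isSym_gpow k) hsym u v]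
  by_cases hz' : ∃ z', z' ≠ z ∧ x z' ≠ y z'
  · obtain ⟨z', hzz', hz'⟩ := hz'
    have hP := dmul_gpow_eq_of_two_ne (R := R) hxy hvu hv₂ hu' hzz' hz' hz
    rw [← hP]
    by_cases hz'' : ∃ z'', z'' ≠ z ∧ z'' ≠ z' ∧ x z'' ≠ y z''
    · obtain ⟨z'', h₁, h₂, hz''⟩ := hz''
      rw [dmul_gpow_eq_zero_of_three_ne hxy h₁ h₂ hzz'.symm hz'' hz hz', mul_zero]
    · push Not at hz''
      let π : Equiv.Perm (Fin n) := Equiv.swap (x z) (y z) * Equiv.swap (x z') (y z')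
      have hπu : v = π ∘ u := by
        funext i
        simp only [π, Function.comp_apply, Equiv.Perm.mul_apply, Equiv.swap_apply_def]
        grind
      have hπx : y = π ∘ x := by
        funext i
        simp only [π, Function.comp_apply, Equiv.Perm.mul_apply, Equiv.swap_apply_def]
        grind
      have : epsPair h v y = epsPair h u x := by
        rw [hπu, hπx, epsPair_perm_comp, Equiv.Perm.sign_mul, Equiv.Perm.sign_swap hz,
          Equiv.Perm.sign_swap hz']
        simp
      rw [this, hE, one_mul]
  · push Not at hz'
    let π : Equiv.Perm (Fin n) := Equiv.swap (x z) (y z)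
    have hπu : v = π ∘ u := by
      funext i
      simp only [π, Function.comp_apply, Equiv.swap_apply_def]
      grind
    have hπx : y = π ∘ x := by
      funext i
      simp only [π, Function.comp_apply, Equiv.swap_apply_def]
      grind
    have hneg : epsPair h v y = -epsPair h u x := by
      rw [hπu, hπx, epsPair_perm_comp, Equiv.Perm.sign_swap hz]
      simp
    have hpat (i j : Fin (k + 2)) : x i = y j ↔ i = j ∧ i ≠ z := by grind
    have hP := dmul_gpow_add_eq_zero h hR hric hu hx hux hpat
      (fun i j => (hvu i j).symm.trans (hpat i j)) (hv₂ z hz) (hu' z hz)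
    rw [hneg]
    linear_combination (-dmul (gpow n k) R v u) * hE - hP

lemma dmul_gpow_mul_midStar_nonneg (h : n = (k + 2) + (k + 2)) {R : DForm n 2 2} (hR : IsAlt R)
    (hsym : IsSym R) (hric : ∀ a b, a ≠ b → ∑ c, R ![c, a] ![c, b] = 0)
    (hpos : ∀ x, Function.Injective x → 0 ≤ dmul (gpow n k) R x x)
    (hpos' : ∀ x, Function.Injective x → 0 ≤ midStar h (dmul (gpow n k) R) x x)
    (x y : Fin (k + 2) → Fin n) :
    0 ≤ dmul (gpow n k) R x y * midStar h (dmul (gpow n k) R) x y := by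
  have halt := isAlt_dmul (gpow n k) R
  by_cases hx : Function.Injective x
  swap
  · rw [halt.eq_zero_left hx, zero_mul]
  by_cases hy : Function.Injective y
  swap
  · rw [halt.eq_zero_right x hy, zero_mul]
  obtain ⟨τ, hτ⟩ := exists_perm_aligned hx hy
  have hyτ : Function.Injective (y ∘ τ) := hy.comp τ.injective
  have key : 0 ≤ dmul (gpow n k) R x (y ∘ τ) * midStar h (dmul (gpow n k) R) x (y ∘ τ) := by
    by_cases hxy : x = y ∘ τ
    · rw [← hxy]
      exact mul_nonneg (hpos x hx) (hpos' x hx)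
    · obtain ⟨z, hz⟩ := Function.ne_iff.mp hxy
      obtain ⟨u, hu, hux⟩ := exists_disjoint_injective h hx
      obtain ⟨ρ, hρ⟩ := exists_perm_aligned hyτ hu
      rw [midStar_eq_of_aligned h hR hsym hric hx hyτ (hu.comp ρ.injective) hτ
        (fun i j => hux (ρ i) j) hρ hz]
      exact mul_self_nonneg _
  rw [halt.2, (isAlt_midStar h _).2, mul_mul_mul_comm, perm_sign_mul_self, one_mul] at key
  exact key

lemma exists_rotate_contr_diagonal {R : DForm n 2 2} (hsym : IsSym R) :
    ∃ O : Matrix (Fin n) (Fin n) ℝ, O * O.transpose = 1 ∧ O.transpose * O = 1 ∧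
      ∀ a b, a ≠ b → ∑ c, rotate O R ![c, a] ![c, b] = 0 := by
  let A : Matrix (Fin n) (Fin n) ℝ := .of fun a b => contr (p := 1) (q := 1) R ![a] ![b]
  have hA : A.IsHermitian := by
    ext a b
    change contr (p := 1) (q := 1) R ![b] ![a] = contr (p := 1) (q := 1) R ![a] ![b]
    exact Finset.sum_congr rfl fun c _ => hsym (Fin.cons c ![b]) (Fin.cons c ![a])
  let U : Matrix (Fin n) (Fin n) ℝ := hA.eigenvectorUnitary
  have hU : U.transpose * U = 1 := Unitary.coe_star_mul_self hA.eigenvectorUnitary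
  have hU' : U * U.transpose = 1 := Unitary.coe_mul_star_self hA.eigenvectorUnitary
  refine ⟨U.transpose, by rwa [U.transpose_transpose], by rwa [U.transpose_transpose],
    fun a b hab => ?_⟩
  have hD : U.transpose * A * U = Matrix.diagonal (RCLike.ofReal ∘ hA.eigenvalues) := by
    rw [← hA.conjStarAlgAut_star_eigenvectorUnitary, Unitary.conjStarAlgAut_star_apply]
    rfl
  have hab' := congrFun (congrFun hD a) b
  rw [Matrix.diagonal_apply_ne _ hab] at hab'
  have hc := contr_rotate (p := 1) (q := 1) U.transpose (by rwa [U.transpose_transpose]) R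
  refine (congrFun (congrFun hc ![a]) ![b]).trans (Eq.trans ?_ hab')
  simp only [rotate, push_singleton, Matrix.mul_apply, Matrix.transpose_apply, A, Matrix.of_apply,
    Finset.mul_sum, Finset.sum_mul]
  rw [Finset.sum_comm]
  exact Finset.sum_congr rfl fun i _ => Finset.sum_congr rfl fun j _ => by ring

end Positivity

/-- Theorem A (key positivity estimate).  Let `R` be an algebraic curvature tensor on
a Euclidean space of even dimension `n = 2(k+2) ≥ 4`.  If both `g^k R` and
`*(g^k R)` have nonnegative sectional curvature (nonnegative values on all
decomposable `(k+2)`-vectors built from orthonormal families), then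
`h₄ = (1/(2k)!)·⟨g^k R, *(g^k R)⟩ ≥ 0`. -/
theorem h4_nonneg_of_sec_nonneg (n k : ℕ) (hn : n = 2 * (k + 2))
    (R : DForm n 2 2) (halt : IsAlt R) (hsym : IsSym R)
    (hbia : FirstBianchi (n := n) (p := 2) (q := 1) R)
    (P : DForm n (k + 2) (k + 2)) (hP : P = dmul (gpow n k) R)
    (hpos : ∀ v : Fin (k + 2) → (Fin n → ℝ),
      (∀ i j, (∑ a, v i a * v j a) = if i = j then (1 : ℝ) else 0) →
      0 ≤ evalD P v v)
    (hposstar : ∀ v : Fin (k + 2) → (Fin n → ℝ),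
      (∀ i j, (∑ a, v i a * v j a) = if i = j then (1 : ℝ) else 0) →
      0 ≤ evalD (castD (show n - (k + 2) = k + 2 by omega) (show n - (k + 2) = k + 2 by omega)
            (dstar (show k + 2 ≤ n by omega) (show k + 2 ≤ n by omega) P)) v v) :
    0 ≤ (1 / ((2 * k).factorial : ℝ)) *
        dinner P
          (castD (show n - (k + 2) = k + 2 by omega) (show n - (k + 2) = k + 2 by omega)
            (dstar (show k + 2 ≤ n by omega) (show k + 2 ≤ n by omega) P)) := by

  obtain ⟨O, hO, hO', hric⟩ := exists_rotate_contr_diagonal hsym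
  have h : n = (k + 2) + (k + 2) := by omega
  subst hP
  rw [castD_dstar_eq_midStar h] at hposstar ⊢
  have hrows {x : Fin (k + 2) → Fin n} (hx : Function.Injective x) (i j : Fin (k + 2)) :
      ∑ a, O (x i) a * O (x j) a = if i = j then (1 : ℝ) else 0 := by
    simpa [Matrix.mul_apply, Matrix.one_apply, hx.eq_iff] using
      congrFun (congrFun hO (x i)) (x j)
  have hrot : rotate O (dmul (gpow n k) R) = dmul (gpow n k) (rotate O R) := by
    rw [rotate_dmul, rotate_gpow O hO]
  have hnonneg := dmul_gpow_mul_midStar_nonneg h (isAlt_rotate O halt) (isSym_rotate O hsym) hric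
    (fun x hx => by
      rw [← hrot, ← evalD_eq_rotate]
      exact hpos _ (hrows hx))
    (fun x hx => by
      rw [← hrot, ← rotate_midStar h hO', ← evalD_eq_rotate]
      exact hposstar _ (hrows hx))
  rw [← dinner_rotate O hO', rotate_midStar h hO', hrot, dinner]
  exact mul_nonneg (by positivity) (mul_nonneg (by positivity)
    (Finset.sum_nonneg fun x _ => Finset.sum_nonneg fun y _ => hnonneg x y))

end
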